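/- Let 𝔤 be a complex semisimple Lie algebra with reductive subalgebra 𝔤', and let 𝔭 be a parabolic subalgebra of 𝔤. Fix any maximal toral subalgebra 𝔥' of 𝔭' := 𝔭 ∩ 𝔤'. Then 𝔭 is 𝔤'-compatible (i.e., 𝔭 = 𝔭(H) for some hyperbolic element H ∈ 𝔤') if and only if there exists a hyperbolic element H ∈ 𝔥' with 𝔭 = 𝔭(H). -/

import Mathlib

section

variable {g : Type} [LieRing g] [LieAlgebra ℂ g]

/-- The adjoint endomorphism `ad(x)`. -/
noncomputable def adE (x : g) : Module.End ℂ g := LieAlgebra.ad ℂ g x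

/-- A semisimple element `H` of a complex Lie algebra is *hyperbolic* if `ad(H)` is a
semisimple endomorphism all of whose eigenvalues are real. -/
def IsHyperbolicElt (H : g) : Prop :=
  (adE H).IsSemisimple ∧ ∀ μ ∈ spectrum ℂ (adE H), μ.im = 0

/-- For a hyperbolic element `H`, the parabolic subalgebra `𝔭(H)`: the sum of the
eigenspaces of `ad(H)` with nonnegative (real) eigenvalue. -/
noncomputable def pSub (H : g) : Submodule ℂ g :=
  ⨆ c : {r : ℝ // 0 ≤ r}, Module.End.eigenspace (adE H) ((c : ℝ) : ℂ)

/-- A submodule `t` is a *toral* subalgebra contained in `q` if it is abelian and all of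
its elements are `ad`-semisimple. -/
def IsToralIn (t q : Submodule ℂ g) : Prop :=
  t ≤ q ∧ (∀ x ∈ t, ∀ y ∈ t, ⁅x, y⁆ = (0 : g)) ∧ ∀ x ∈ t, (adE x).IsSemisimple

/-- A Lie subalgebra is reductive if its radical equals its center. -/
def IsReductiveSub (g' : LieSubalgebra ℂ g) : Prop :=
  LieAlgebra.radical ℂ ↥g' = LieAlgebra.center ℂ ↥g'

end

open Module.End Polynomial in
/-- For a semisimple operator `f`, the operator `1 - r(f) f` projects onto the kernel of `f`. -/
lemma Module.End.IsSemisimple.exists_aeval_mul_sq {V : Type*} [AddCommGroup V] [Module ℂ V]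
    [FiniteDimensional ℂ V] {f : Module.End ℂ V} (hf : f.IsSemisimple) :
    ∃ r : ℂ[X], aeval f r * f * f = f := by
  have hsq := hf.minpoly_squarefree
  obtain ⟨r, s, hrs⟩ : ∃ r s : ℂ[X], r * X * X + s * minpoly ℂ f = X := by
    by_cases hX : (X : ℂ[X]) ∣ minpoly ℂ f
    · obtain ⟨q, hq⟩ := hX
      have hXq : ¬ (X : ℂ[X]) ∣ q := by
        rintro ⟨q', rfl⟩
        exact not_isUnit_X (hsq X ⟨q', by rw [hq]; ring⟩)
      obtain ⟨a, b, hab⟩ := (irreducible_X (R := ℂ)).coprime_iff_not_dvd.2 hXq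
      exact ⟨a, b, by rw [hq]; linear_combination X * hab⟩
    · obtain ⟨a, b, hab⟩ := (irreducible_X (R := ℂ)).coprime_iff_not_dvd.2 hX
      exact ⟨a, b * X, by linear_combination X * hab⟩
  refine ⟨r, ?_⟩
  simpa using congrArg (aeval f) hrs

open Module.End Polynomial in
/-- Simultaneous kernel vectors: if commuting semisimple operators preserve `W` and send `v` into
`W`, then some element of the coset `v + W` is killed by all of them. -/
lemma exists_add_mem_forall_apply_eq_zero {V : Type*} [AddCommGroup V] [Module ℂ V]
    [FiniteDimensional ℂ V] (W : Submodule ℂ V) (s : Finset (Module.End ℂ V)) (v : V)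
    (hss : ∀ f ∈ s, f.IsSemisimple) (hcomm : ∀ f ∈ s, ∀ e ∈ s, Commute f e)
    (hW : ∀ f ∈ s, ∀ w ∈ W, f w ∈ W) (hv : ∀ f ∈ s, f v ∈ W) :
    ∃ w ∈ W, ∀ f ∈ s, f (v + w) = 0 := by
  classical
  induction s using Finset.induction_on with
  | empty => exact ⟨0, W.zero_mem, by simp⟩
  | insert f s _ ih =>
    simp only [Finset.mem_insert, forall_eq_or_imp] at hss hcomm hW hv
    obtain ⟨w, hw, h0⟩ := ih hss.2 (fun e he e' he' => (hcomm.2 e he).2 e' he') hW.2 hv.2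
    obtain ⟨r, hr⟩ := hss.1.exists_aeval_mul_sq
    have hfw : f (v + w) ∈ W := by
      rw [map_add]; exact W.add_mem hv.1 (hW.1 w hw)
    refine ⟨w - aeval f r (f (v + w)), W.sub_mem hw ?_, ?_⟩
    · exact r.aeval_apply_smul_mem_of_le_comap hfw f hW.1
    · simp only [Finset.mem_insert, forall_eq_or_imp, ← add_sub_assoc, map_sub]
      have hcr : Commute f (aeval f r) := by
        simpa using (Commute.all (X : ℂ[X]) r).map (aeval f)
      refine ⟨?_, fun e he => ?_⟩
      · have h1 := LinearMap.congr_fun hcr (f (v + w))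
        have h2 := LinearMap.congr_fun hr (v + w)
        simp only [Module.End.mul_apply] at h1 h2
        rw [h1, h2, sub_self]
      · have hef (x : V) : e (f x) = f (e x) := LinearMap.congr_fun (hcomm.2 e he).1 x
        have hker : aeval f r (f (v + w)) ∈ LinearMap.ker e :=
          r.aeval_apply_smul_mem_of_le_comap (q := LinearMap.ker e)
            (by rw [LinearMap.mem_ker, hef, h0 e he, map_zero]) f
            fun x hx => by
              rw [Submodule.mem_comap, LinearMap.mem_ker, hef, LinearMap.mem_ker.1 hx, map_zero]
        rw [h0 e he, LinearMap.mem_ker.1 hker, sub_self]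

/-- The sum of the eigenspaces of `f` for the real eigenvalues in `U`. -/
noncomputable def realEigenSum {V : Type*} [AddCommGroup V] [Module ℂ V]
    (f : Module.End ℂ V) (U : Set ℝ) : Submodule ℂ V :=
  ⨆ c ∈ U, Module.End.eigenspace f (c : ℂ)

section

variable {V : Type*} [AddCommGroup V] [Module ℂ V]

lemma eigenspace_le_realEigenSum (f : Module.End ℂ V) {U : Set ℝ} {c : ℝ} (hc : c ∈ U) :
    Module.End.eigenspace f (c : ℂ) ≤ realEigenSum f U :=
  le_iSup₂_of_le c hc le_rfl

lemma realEigenSum_le_of_forall {f : Module.End ℂ V} {U U' : Set ℝ}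
    (h : ∀ c ∈ U, c ∈ U' ∨ Module.End.eigenspace f (c : ℂ) = ⊥) :
    realEigenSum f U ≤ realEigenSum f U' := by
  refine iSup₂_le fun c hc => ?_
  rcases h c hc with h | h
  · exact eigenspace_le_realEigenSum f h
  · rw [h]; exact bot_le

lemma realEigenSum_mono (f : Module.End ℂ V) {U U' : Set ℝ} (h : U ⊆ U') :
    realEigenSum f U ≤ realEigenSum f U' :=
  realEigenSum_le_of_forall fun _ hc => Or.inl (h hc)

lemma map_realEigenSum_le (f : Module.End ℂ V) (U : Set ℝ) (W : Submodule ℂ V)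
    (e : Module.End ℂ V)
    (h : ∀ c ∈ U, ∀ x ∈ Module.End.eigenspace f (c : ℂ), e x ∈ W) :
    ∀ x ∈ realEigenSum f U, e x ∈ W := by
  have : realEigenSum f U ≤ W.comap e := iSup₂_le fun c hc x hx => h c hc x hx
  exact this

open Polynomial in
/-- If `e` strictly raises eigenvalues of `f`, the product of the `f + e - c` over a lowest set of
eigenvalues maps into the span of the remaining eigenspaces. -/
lemma aeval_prod_mem_realEigenSum (f e : Module.End ℂ V)
    (he : ∀ c : ℝ, ∀ x ∈ Module.End.eigenspace f (c : ℂ), e x ∈ realEigenSum f (Set.Ioi c))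
    (s : Finset ℝ) (U : Set ℝ) (hsU : ∀ c ∈ s, ∀ d ∈ U, c < d)
    (hup : ∀ c : ℝ, (c ∈ s ∨ c ∈ U) → ∀ d, c < d →
      (d ∈ s ∨ d ∈ U) ∨ Module.End.eigenspace f (d : ℂ) = ⊥) :
    ∀ x ∈ realEigenSum f (s ∪ U),
      aeval (f + e) (∏ c ∈ s, (X - C (c : ℂ))) x ∈ realEigenSum f U := by
  classical
  induction s using Finset.induction_on_max generalizing U with
  | empty => intro x hx; simpa using hx
  | insert m s hm ih =>
    intro x hx
    have hms : m ∉ s := fun h => lt_irrefl _ (hm m h)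
    rw [Finset.prod_insert hms, map_mul, Module.End.mul_apply]
    have key := ih (insert m U) ?_ ?_ x ?_
    · refine map_realEigenSum_le f _ _ _ ?_ _ key
      have hmU : ∀ d ∈ U, m < d := fun d hd => hsU m (by simp) d hd
      have hU : ∀ c ∈ insert m U, realEigenSum f (Set.Ioi c) ≤ realEigenSum f U := by
        intro c hc
        refine realEigenSum_le_of_forall fun d hd => ?_
        have hmc : m ≤ c := by
          rcases hc with rfl | hc
          · exact le_rfl
          · exact (hmU c hc).le
        have hmd : m < d := lt_of_le_of_lt hmc hd
        rcases hup m (by simp) d hmd with (h | h) | h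
        · rcases Finset.mem_insert.1 h with rfl | h
          · exact absurd hmd (lt_irrefl _)
          · exact absurd hmd (hm d h).le.not_gt
        · exact Or.inl h
        · exact Or.inr h
      intro c hc y hy
      have hfy : f y = (c : ℂ) • y := Module.End.mem_eigenspace_iff.1 hy
      have hval : aeval (f + e) (X - C (m : ℂ)) y = ((c : ℂ) - (m : ℂ)) • y + e y := by
        simp [hfy, sub_smul, Module.algebraMap_end_apply]; abel
      rw [hval]
      refine Submodule.add_mem _ ?_ (hU c hc (he c y hy))
      rcases hc with rfl | hc
      · simp
      · exact Submodule.smul_mem _ _ (eigenspace_le_realEigenSum f hc hy)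
    · intro c hc d hd
      rcases hd with rfl | hd
      · exact hm c hc
      · exact hsU c (by simp [hc]) d hd
    · intro c hc d hcd
      have := hup c (by simp only [Finset.mem_insert, Set.mem_insert_iff] at hc ⊢; tauto) d hcd
      simp only [Finset.mem_insert, Set.mem_insert_iff] at this ⊢
      tauto
    · refine realEigenSum_mono f ?_ hx
      intro c hc
      simp only [Finset.coe_insert, Set.mem_union, Set.mem_insert_iff] at hc ⊢
      tauto

open Polynomial in
lemma mem_realEigenSum_of_aeval_prod_eq_zero (f : Module.End ℂ V) (s : Finset ℝ) (x : V)
    (hx : aeval f (∏ c ∈ s, (X - C (c : ℂ))) x = 0) : x ∈ realEigenSum f s := by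
  classical
  induction s using Finset.induction_on generalizing x with
  | empty => simpa [realEigenSum] using hx
  | insert m s hm ih =>
    rw [Finset.prod_insert hm] at hx
    have hcop : IsCoprime (X - C (m : ℂ)) (∏ c ∈ s, (X - C (c : ℂ))) := by
      refine IsCoprime.prod_right fun c hc => ?_
      refine isCoprime_X_sub_C_of_isUnit_sub (sub_ne_zero.2 ?_).isUnit
      exact fun h => hm (by rw [Complex.ofReal_injective h]; exact hc)
    have hk := sup_ker_aeval_eq_ker_aeval_mul_of_coprime f hcop
    rw [← LinearMap.mem_ker, ← hk] at hx
    obtain ⟨y, hy, z, hz, rfl⟩ := Submodule.mem_sup.1 hx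
    refine Submodule.add_mem _ ?_ ?_
    · refine eigenspace_le_realEigenSum f (c := m) (by simp) ?_
      rw [Module.End.mem_eigenspace_iff, ← sub_eq_zero]
      simpa [Module.algebraMap_end_apply] using hy
    · exact realEigenSum_mono f (by simp) (ih z hz)

variable [FiniteDimensional ℂ V]

open Polynomial in
/-- Perturbing a diagonalizable operator with real eigenvalues by an operator strictly raising
eigenvalues gives a diagonalizable operator with real eigenvalues, and the sum of the eigenspaces
for nonnegative eigenvalues is unchanged. -/
lemma isSemisimple_add_of_raising (f e : Module.End ℂ V) (hf : f.IsSemisimple)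
    (hreal : ∀ μ ∈ spectrum ℂ f, μ.im = 0)
    (he : ∀ c : ℝ, ∀ x ∈ Module.End.eigenspace f (c : ℂ), e x ∈ realEigenSum f (Set.Ioi c)) :
    (f + e).IsSemisimple ∧ (∀ μ ∈ spectrum ℂ (f + e), μ.im = 0) ∧
      realEigenSum (f + e) (Set.Ici 0) = realEigenSum f (Set.Ici 0) := by
  classical
  obtain ⟨Λ, hΛ⟩ : ∃ Λ : Finset ℝ, ∀ c : ℝ, c ∈ Λ ∨ Module.End.eigenspace f (c : ℂ) = ⊥ := by
    have hfin : {c : ℝ | f.HasEigenvalue (c : ℂ)}.Finite :=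
      f.finite_hasEigenvalue.preimage Complex.ofReal_injective.injOn
    refine ⟨hfin.toFinset, fun c => ?_⟩
    rw [Set.Finite.mem_toFinset, or_iff_not_imp_left]
    exact fun h => not_not.1 h
  have htop : ∀ x, x ∈ realEigenSum f (Λ : Set ℝ) := by
    have : (⊤ : Submodule ℂ V) ≤ realEigenSum f (Λ : Set ℝ) := by
      rw [← hf.iSup_eigenspace_eq_top]
      refine iSup_le fun μ => ?_
      by_cases hμ : f.HasEigenvalue μ
      · have him := hreal μ hμ.mem_spectrum
        have hre : ((μ.re : ℝ) : ℂ) = μ := Complex.ext (by simp) (by simp [him])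
        rw [← hre] at hμ ⊢
        exact eigenspace_le_realEigenSum f ((hΛ _).resolve_right hμ)
      · exact (not_not.1 hμ : Module.End.eigenspace f μ = ⊥).le.trans bot_le
    exact fun x => this trivial
  have hkill : aeval (f + e) (∏ c ∈ Λ, (X - C (c : ℂ))) = 0 := by
    ext x
    have := aeval_prod_mem_realEigenSum f e he Λ ∅ (by simp)
      (fun c _ d _ => (hΛ d).imp_left Or.inl) x (by simpa using htop x)
    simpa [realEigenSum] using this
  have hroot : ∀ (s : Finset ℝ) (μ : ℂ),
      (∏ c ∈ s, (X - C (c : ℂ))).eval μ = 0 → ∃ c ∈ s, μ = (c : ℂ) := by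
    intro s μ h
    simpa [eval_prod, Finset.prod_eq_zero_iff, sub_eq_zero] using h
  refine ⟨?_, ?_, le_antisymm ?_ ?_⟩
  · refine Module.End.isSemisimple_of_squarefree_aeval_eq_zero ?_ hkill
    refine Separable.squarefree ?_
    exact separable_prod_X_sub_C_iff'.2 fun c _ d _ h => Complex.ofReal_injective h
  · intro μ hμ
    rw [← Module.End.hasEigenvalue_iff_mem_spectrum] at hμ
    obtain ⟨x, hx⟩ := hμ.exists_hasEigenvector
    have h := Module.End.aeval_apply_of_hasEigenvector (p := ∏ c ∈ Λ, (X - C (c : ℂ))) hx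
    rw [hkill, LinearMap.zero_apply] at h
    obtain ⟨c, _, rfl⟩ := hroot Λ μ ((smul_eq_zero.1 h.symm).resolve_right hx.2)
    exact Complex.ofReal_im c
  · refine iSup₂_le fun c hc x hx => ?_
    by_cases hx0 : x = 0
    · rw [hx0]; exact Submodule.zero_mem _
    have h := Module.End.aeval_apply_of_hasEigenvector
      (p := ∏ c ∈ Λ with c < 0, (X - C (c : ℂ))) (f := f + e) ⟨hx, hx0⟩
    have hmem := aeval_prod_mem_realEigenSum f e he (Λ.filter (· < 0)) (Set.Ici 0)
      (fun a ha d hd => lt_of_lt_of_le (Finset.mem_filter.1 ha).2 hd)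
      (fun a _ d _ => by
        rcases hΛ d with h | h
        · rcases lt_or_ge d 0 with h0 | h0
          · exact Or.inl (Or.inl (Finset.mem_filter.2 ⟨h, h0⟩))
          · exact Or.inl (Or.inr h0)
        · exact Or.inr h) x
      (realEigenSum_mono f (fun d hd => by
        rcases lt_or_ge d 0 with h0 | h0
        · exact Or.inl (by simpa using ⟨hd, h0⟩)
        · exact Or.inr h0) (htop x))
    rw [h] at hmem
    refine (Submodule.smul_mem_iff _ fun h0 => ?_).1 hmem
    obtain ⟨d, hd, hcd⟩ := hroot _ _ h0
    rw [Complex.ofReal_injective hcd] at hc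
    exact absurd (Finset.mem_filter.1 hd).2 (not_lt.2 hc)
  · intro x hx
    have hx' : x ∈ realEigenSum f ((Λ.filter (0 ≤ ·) : Finset ℝ) : Set ℝ) := by
      refine realEigenSum_le_of_forall (fun c hc => ?_) hx
      exact (hΛ c).imp_left fun h => by simpa using ⟨h, hc⟩
    have hmem := aeval_prod_mem_realEigenSum f e he (Λ.filter (0 ≤ ·)) ∅ (by simp)
      (fun a ha d had => (hΛ d).imp_left fun h => by
        have h0 : 0 ≤ a := (Finset.mem_filter.1 (ha.resolve_right id)).2
        exact Or.inl (Finset.mem_filter.2 ⟨h, h0.trans had.le⟩)) x (by simpa using hx')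
    have h0 : aeval (f + e) (∏ c ∈ Λ with 0 ≤ c, (X - C (c : ℂ))) x = 0 := by
      simpa [realEigenSum] using hmem
    exact realEigenSum_mono _ (fun c hc => (Finset.mem_filter.1 hc).2)
      (mem_realEigenSum_of_aeval_prod_eq_zero _ _ x h0)

end

section

variable {g : Type} [LieRing g] [LieAlgebra ℂ g]

lemma pSub_eq_realEigenSum (H : g) : pSub H = realEigenSum (adE H) (Set.Ici 0) :=
  iSup_subtype (p := fun r : ℝ => 0 ≤ r)
    (f := fun c => Module.End.eigenspace (adE H) (((c : ℝ)) : ℂ))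

lemma adE_apply (x y : g) : adE x y = ⁅x, y⁆ := rfl

lemma adE_add (x y : g) : adE (x + y) = adE x + adE y := map_add _ x y

lemma commute_adE {x y : g} (h : ⁅x, y⁆ = 0) : Commute (adE x) (adE y) := by
  refine LinearMap.ext fun z => ?_
  rw [Module.End.mul_apply, Module.End.mul_apply, adE_apply, adE_apply, adE_apply, adE_apply,
    leibniz_lie, h, zero_lie, zero_add]

lemma lie_mem_realEigenSum (H : g) {U U' U'' : Set ℝ}
    (hU : ∀ a ∈ U, ∀ b ∈ U', a + b ∈ U'') :
    ∀ x ∈ realEigenSum (adE H) U, ∀ y ∈ realEigenSum (adE H) U',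
      ⁅x, y⁆ ∈ realEigenSum (adE H) U'' := by
  intro x hx y hy
  refine map_realEigenSum_le _ U' _ (adE x) (fun b hb y hy => ?_) y hy
  rw [adE_apply, ← lie_skew]
  refine Submodule.neg_mem _ (map_realEigenSum_le _ U _ (adE y) (fun a ha x hx => ?_) x hx)
  rw [adE_apply, ← lie_skew]
  refine Submodule.neg_mem _ (eigenspace_le_realEigenSum _ (hU a ha b hb) ?_)
  rw [Module.End.mem_eigenspace_iff] at hx hy ⊢
  simp only [adE_apply] at hx hy ⊢
  rw [leibniz_lie, hx, hy, smul_lie, lie_smul, Complex.ofReal_add, add_smul]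

variable [FiniteDimensional ℂ g]

/-- Translating a hyperbolic element by an element of the nilradical of its parabolic yields a
hyperbolic element defining the same parabolic. -/
lemma IsHyperbolicElt.add_mem_realEigenSum_Ioi {H n : g} (hH : IsHyperbolicElt H)
    (hn : n ∈ realEigenSum (adE H) (Set.Ioi 0)) :
    IsHyperbolicElt (H + n) ∧ pSub (H + n) = pSub H := by
  have hraise (c : ℝ) (x : g) (hx : x ∈ Module.End.eigenspace (adE H) (c : ℂ)) :
      adE n x ∈ realEigenSum (adE H) (Set.Ioi c) := by
    rw [adE_apply]
    refine lie_mem_realEigenSum H (U := Set.Ioi 0) (U' := {c}) ?_ n hn x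
      (eigenspace_le_realEigenSum _ (Set.mem_singleton c) hx)
    rintro a (ha : 0 < a) b rfl
    exact lt_add_of_pos_left b ha
  obtain ⟨h1, h2, h3⟩ := isSemisimple_add_of_raising (adE H) (adE n) hH.1 hH.2 hraise
  rw [← adE_add] at h1 h2 h3
  exact ⟨⟨h1, h2⟩, by rw [pSub_eq_realEigenSum, pSub_eq_realEigenSum, h3]⟩

/-- A toral subspace can be enlarged by a semisimple element commuting with it. -/
lemma IsToralIn.sup_span_singleton {t q : Submodule ℂ g} (ht : IsToralIn t q) {H : g}
    (hq : H ∈ q) (hH : (adE H).IsSemisimple) (hcomm : ∀ x ∈ t, ⁅x, H⁆ = 0) :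
    IsToralIn (t ⊔ ℂ ∙ H) q := by
  have hcomm' : ∀ x ∈ t, ⁅H, x⁆ = 0 := fun x hx => by rw [← lie_skew, hcomm x hx, neg_zero]
  refine ⟨sup_le ht.1 ((Submodule.span_singleton_le_iff_mem _ _).2 hq), ?_, ?_⟩
  · intro x hx y hy
    obtain ⟨x, hxt, _, hx', rfl⟩ := Submodule.mem_sup.1 hx
    obtain ⟨y, hyt, _, hy', rfl⟩ := Submodule.mem_sup.1 hy
    obtain ⟨a, rfl⟩ := Submodule.mem_span_singleton.1 hx'
    obtain ⟨b, rfl⟩ := Submodule.mem_span_singleton.1 hy'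
    simp [ht.2.1 x hxt y hyt, hcomm x hxt, hcomm' y hyt]
  · intro x hx
    obtain ⟨x, hxt, _, hx', rfl⟩ := Submodule.mem_sup.1 hx
    obtain ⟨a, rfl⟩ := Submodule.mem_span_singleton.1 hx'
    rw [adE_add]
    refine Module.End.IsSemisimple.add_of_commute (commute_adE (by simp [hcomm x hxt]))
      (ht.2.2 x hxt) ?_
    rw [show adE (a • H) = a • adE H from map_smul _ a H]
    exact Module.End.IsSemisimple_smul a hH

end

/-- Lemma 3.6. Let `𝔤` be a complex semisimple Lie algebra, `𝔤'` a
reductive subalgebra, and `𝔭` a parabolic subalgebra of `𝔤` (i.e. `𝔭 = 𝔭(H₀)` for some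
hyperbolic `H₀ ∈ 𝔤`).  Fix a maximal toral subalgebra `𝔥'` of `𝔭' = 𝔭 ∩ 𝔤'`.  Then `𝔭`
is `𝔤'`-compatible (equal to `𝔭(H)` for a hyperbolic `H ∈ 𝔤'`) iff such an `H` can be
found in `𝔥'`. -/
theorem stmt4 {g : Type} [LieRing g] [LieAlgebra ℂ g]
    [LieAlgebra.IsSemisimple ℂ g] [FiniteDimensional ℂ g]
    (g' : LieSubalgebra ℂ g) (hred : IsReductiveSub g')
    (p : Submodule ℂ g) (hpar : ∃ H0 : g, IsHyperbolicElt H0 ∧ p = pSub H0)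
    (h' : Submodule ℂ g)
    (htoral : IsToralIn h' (p ⊓ g'.toSubmodule))
    (hmax : ∀ t : Submodule ℂ g, IsToralIn t (p ⊓ g'.toSubmodule) → h' ≤ t → t = h') :
    (∃ H : g, H ∈ g' ∧ IsHyperbolicElt H ∧ p = pSub H) ↔
    (∃ H : g, H ∈ h' ∧ IsHyperbolicElt H ∧ p = pSub H) := by
  constructor
  swap
  · rintro ⟨H, hH, h⟩
    exact ⟨H, (htoral.1 hH).2, h⟩
  rintro ⟨H, hHg, hH, rfl⟩
  set u := realEigenSum (adE H) (Set.Ioi 0) with hu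
  have hup : u ≤ pSub H := by
    rw [pSub_eq_realEigenSum]
    exact realEigenSum_mono _ Set.Ioi_subset_Ici_self
  have hpH : ∀ x ∈ pSub H, ⁅x, H⁆ ∈ u := by
    intro x hx
    rw [pSub_eq_realEigenSum] at hx
    rw [← lie_skew]
    refine Submodule.neg_mem _ (map_realEigenSum_le _ _ u (adE H) (fun c hc y hy => ?_) x hx)
    rw [Module.End.mem_eigenspace_iff.1 hy]
    rcases eq_or_lt_of_le (Set.mem_Ici.1 hc) with rfl | hc
    · simp
    · exact Submodule.smul_mem _ _ (eigenspace_le_realEigenSum _ hc hy)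
  classical
  obtain ⟨s, hs⟩ := (IsNoetherian.noetherian h' : h'.FG)
  have hsh : ∀ x ∈ s, x ∈ h' := fun x hx => hs ▸ Submodule.subset_span hx
  obtain ⟨n, ⟨hnu, hng⟩, hn⟩ := exists_add_mem_forall_apply_eq_zero (u ⊓ g'.toSubmodule)
    (s.image adE) H
    (by simpa only [Finset.forall_mem_image] using fun x hx => htoral.2.2 x (hsh x hx))
    (by
      simp only [Finset.forall_mem_image]
      exact fun x hx y hy => commute_adE (htoral.2.1 x (hsh x hx) y (hsh y hy)))
    (by
      simp only [Finset.forall_mem_image]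
      rintro x hx y ⟨hyu, hyg⟩
      obtain ⟨hxp, hxg⟩ := htoral.1 (hsh x hx)
      rw [SetLike.mem_coe, pSub_eq_realEigenSum] at hxp
      exact ⟨lie_mem_realEigenSum H (fun a ha b hb => add_pos_of_nonneg_of_pos ha hb) x hxp y hyu,
        g'.lie_mem hxg hyg⟩)
    (by
      simp only [Finset.forall_mem_image]
      intro x hx
      obtain ⟨hxp, hxg⟩ := htoral.1 (hsh x hx)
      exact ⟨hpH x hxp, g'.lie_mem hxg hHg⟩)
  simp only [Finset.forall_mem_image] at hn
  have hcomm : ∀ x ∈ h', ⁅x, H + n⁆ = 0 := by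
    intro x hx
    rw [← hs] at hx
    induction hx using Submodule.span_induction with
    | mem x hx => exact hn hx
    | zero => simp
    | add x y _ _ hx hy => rw [add_lie, hx, hy, add_zero]
    | smul a x _ hx => rw [smul_lie, hx, smul_zero]
  obtain ⟨hhyp, hpn⟩ := hH.add_mem_realEigenSum_Ioi hnu
  have hHp : H ∈ pSub H := by
    rw [pSub_eq_realEigenSum]
    refine eigenspace_le_realEigenSum _ (c := 0) Set.self_mem_Ici ?_
    simp [adE]
  have htor := htoral.sup_span_singleton (H := H + n)
    ⟨Submodule.add_mem _ hHp (hup hnu), Submodule.add_mem _ hHg hng⟩ hhyp.1 hcomm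
  refine ⟨H + n, ?_, hhyp, hpn.symm⟩
  rw [← hmax _ htor le_sup_left]
  exact Submodule.mem_sup_right (Submodule.mem_span_singleton_self _)
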